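/- Let E be an elliptic curve over F_q with n = #E(F_q) ≥ 12 rational points, and let 3 ≤ k ≤ n−1. Then the k-elliptic code associated to E is near-MDS (in particular it is not MDS); equivalently, there exists a hyperplane H of P^{k−1}(F_q) meeting φ_k(E(F_q)) in exactly k points. -/

import Mathlib

set_option linter.unusedSectionVars false

namespace NMDS

open WeierstrassCurve

variable {F : Type} [Field F] [Fintype F] [DecidableEq F]

/-- `ψ_i(X,Y)`: `Y^s` if `i = 3s` (`s ≥ 1`), `X·Y^s` if `i = 3s+2` (`s ≥ 0`),
`X²·Y^s` if `i = 3s+4` (`s ≥ 0`). -/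
def psi (i : ℕ) (X Y : F) : F :=
  if i % 3 = 0 then Y ^ (i / 3)
  else if i % 3 = 2 then X * Y ^ (i / 3)
  else X ^ 2 * Y ^ ((i - 4) / 3)

/-- The coordinate vector of `φ_k(P)`: `(1, ψ₂(P), …, ψ_k(P))` for an affine point `P`,
and `(0, …, 0, 1)` for the point at infinity. -/
def phiVec (W : WeierstrassCurve F) (k : ℕ) : W.toAffine.Point → (Fin k → F)
  | .zero => fun j => if (j : ℕ) = k - 1 then 1 else 0
  | .some (x := x) (y := y) _ => fun j => if (j : ℕ) = 0 then 1 else psi ((j : ℕ) + 1) x y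

lemma phiVec_ne_zero (W : WeierstrassCurve F) {k : ℕ} (hk : 0 < k)
    (P : W.toAffine.Point) : phiVec W k P ≠ 0 := by
  cases P with
  | zero =>
    intro h
    have := congrFun h ⟨k - 1, by omega⟩
    simp [phiVec] at this
  | some h' =>
    intro h
    have := congrFun h ⟨0, hk⟩
    simp [phiVec] at this

/-- The image of a rational point of `E` in `P^{k-1}(F_q)` under `φ_k`. -/
noncomputable def phiProj (W : WeierstrassCurve F) {k : ℕ} (hk : 0 < k)
    (P : W.toAffine.Point) : Projectivization F (Fin k → F) :=
  Projectivization.mk F (phiVec W k P) (phiVec_ne_zero W hk P)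

/-- The `k`-elliptic code associated to `E`, relative to an enumeration `e` of the `n`
rational points of `E`: the span of the rows of the `k × n` matrix whose `j`-th column
is `φ_k(P_j)`. -/
def ellipticCode (W : WeierstrassCurve F) (k : ℕ) {n : ℕ}
    (e : Fin n ≃ W.toAffine.Point) : Submodule F (Fin n → F) :=
  Submodule.span F (Set.range fun i : Fin k => fun j : Fin n => phiVec W k (e j) i)

/-- The minimum distance (= minimum weight) of a linear code. -/
noncomputable def minDist {n : ℕ} (C : Submodule F (Fin n → F)) : ℕ :=
  sInf {d | ∃ x ∈ C, x ≠ 0 ∧ hammingNorm x = d}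

/-- The standard inner product with `y` as a linear map. -/
def dotLin {n : ℕ} (y : Fin n → F) : (Fin n → F) →ₗ[F] F where
  toFun x := ∑ i, x i * y i
  map_add' a b := by simp [add_mul, Finset.sum_add_distrib]
  map_smul' c a := by simp [Finset.mul_sum, mul_assoc]

/-- The dual code: all vectors orthogonal to every codeword. -/
def dualCode {n : ℕ} (C : Submodule F (Fin n → F)) : Submodule F (Fin n → F) :=
  ⨅ y ∈ C, LinearMap.ker (dotLin y)

/-- The Singleton defect `s(C) = n - k + 1 - d` of a code of length `n`. -/
noncomputable def singletonDefect {n : ℕ} (C : Submodule F (Fin n → F)) : ℤ :=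
  (n : ℤ) + 1 - Module.finrank F C - minDist C

/-- A code is MDS if its Singleton defect is zero. -/
noncomputable def IsMDS {n : ℕ} (C : Submodule F (Fin n → F)) : Prop :=
  singletonDefect C = 0

/-- A code is near-MDS if both it and its dual have Singleton defect one. -/
noncomputable def IsNMDS {n : ℕ} (C : Submodule F (Fin n → F)) : Prop :=
  singletonDefect C = 1 ∧ singletonDefect (dualCode C) = 1

/-- An `[n,k,d]_q` code `C` is `h`-extendable if there is an `[n+h,k,d+h]_q` code `C'`
whose projection on the first `n` coordinates is `C`. -/
noncomputable def IsHExtendable {n : ℕ} (h : ℕ) (C : Submodule F (Fin n → F)) : Prop :=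
  ∃ C' : Submodule F (Fin (n + h) → F),
    Module.finrank F C' = Module.finrank F C ∧
    minDist C' = minDist C + h ∧
    Submodule.map (LinearMap.funLeft F F (Fin.castAdd h)) C' = C

/-- The point `p` of `P^{k-1}(F_q)` lies on the hyperplane with coefficient vector `a`. -/
def OnHyp {k : ℕ} (a : Fin k → F) (p : Projectivization F (Fin k → F)) : Prop :=
  ∑ i, a i * p.rep i = 0

/-- An `(·; k, k-2)`-set in `P^{k-1}(F_q)`: no `k+1` of its points lie on a common hyperplane,
i.e. every hyperplane contains at most `k` of its points. -/
def IsArcSet (k : ℕ) (S : Set (Projectivization F (Fin k → F))) : Prop :=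
  ∀ a : Fin k → F, a ≠ 0 → Set.ncard {p ∈ S | OnHyp a p} ≤ k

/-- A complete `(·; k, k-2)`-set: maximal with respect to set-theoretical inclusion. -/
def IsCompleteArcSet (k : ℕ) (S : Set (Projectivization F (Fin k → F))) : Prop :=
  IsArcSet k S ∧ ∀ T, IsArcSet k T → S ⊆ T → T = S

/-- Evaluation of the homogeneous cubic of a Weierstrass curve:
`Y²Z + a₁XYZ + a₃YZ² - X³ - a₂X²Z - a₄XZ² - a₆Z³`. -/
def cubicEval {R : Type*} [CommRing R] (W : WeierstrassCurve R) (x y z : R) : R :=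
  y ^ 2 * z + W.a₁ * x * y * z + W.a₃ * y * z ^ 2
    - (x ^ 3 + W.a₂ * x ^ 2 * z + W.a₄ * x * z ^ 2 + W.a₆ * z ^ 3)

/-- The gradient of the homogeneous cubic of a Weierstrass curve. -/
def gradEval {R : Type*} [CommRing R] (W : WeierstrassCurve R) (x y z : R) : Fin 3 → R :=
  ![W.a₁ * y * z - (3 * x ^ 2 + 2 * W.a₂ * x * z + W.a₄ * z ^ 2),
    2 * y * z + W.a₁ * x * z + W.a₃ * z ^ 2,
    y ^ 2 + W.a₁ * x * y + 2 * W.a₃ * y * z - (W.a₂ * x ^ 2 + 2 * W.a₄ * x * z + 3 * W.a₆ * z ^ 2)]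

/-- The point `p` of `P²(F_q)` lies on the plane cubic `E`. -/
def OnCurve (W : WeierstrassCurve F) (p : Projectivization F (Fin 3 → F)) : Prop :=
  cubicEval W (p.rep 0) (p.rep 1) (p.rep 2) = 0

/-- A line of `P²(F_q)`, given by its coefficient vector `l`, is a tangent of `E`:
it touches the curve at some point (over the algebraic closure) with multiplicity at
least two, i.e. it is the tangent line of the cubic at a contact point. -/
def IsTangentLine (W : WeierstrassCurve F) (l : Fin 3 → F) : Prop :=
  ∃ v : Fin 3 → AlgebraicClosure F, v ≠ 0 ∧
    cubicEval (W.baseChange (AlgebraicClosure F)) (v 0) (v 1) (v 2) = 0 ∧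
    (∑ i, algebraMap F (AlgebraicClosure F) (l i) * v i) = 0 ∧
    ∃ t : AlgebraicClosure F, t ≠ 0 ∧
      gradEval (W.baseChange (AlgebraicClosure F)) (v 0) (v 1) (v 2) =
        t • fun i => algebraMap F (AlgebraicClosure F) (l i)

/-- A line of `P²(F_q)` intersects `E` in three distinct `F_q`-rational points. -/
def IsThreeSecant (W : WeierstrassCurve F) (l : Fin 3 → F) : Prop :=
  ∃ u v w : Projectivization F (Fin 3 → F), u ≠ v ∧ u ≠ w ∧ v ≠ w ∧
    OnCurve W u ∧ OnCurve W v ∧ OnCurve W w ∧ OnHyp l u ∧ OnHyp l v ∧ OnHyp l w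

/-- In a finite abelian group that is not of exponent two, every proper cardinality is attained by
a subset with sum zero. -/
theorem exists_card_eq_sum_eq_zero {G : Type*} [AddCommGroup G] [Fintype G] [DecidableEq G]
    {g : G} (hg : g + g ≠ 0) {k : ℕ} (hk : 1 ≤ k) (hkn : k < Fintype.card G) :
    ∃ S : Finset G, S.card = k ∧ ∑ x ∈ S, x = 0 := by
  by_contra! H
  have swap : ∀ S : Finset G, S.card = k → ∀ x ∈ S, ∀ y ∉ S,
      (insert y (S.erase x)).card = k ∧
        ∑ z ∈ insert y (S.erase x), z = ∑ z ∈ S, z + y - x := by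
    intro S hS x hx y hy
    have hy' : y ∉ S.erase x := fun h => hy (Finset.mem_of_mem_erase h)
    refine ⟨?_, ?_⟩
    · rw [Finset.card_insert_of_notMem hy', Finset.card_erase_of_mem hx]; omega
    · rw [Finset.sum_insert hy', ← Finset.sum_erase_add S _ hx]; abel
  have sub_mem : ∀ S : Finset G, S.card = k → ∀ x ∈ S, x - ∑ z ∈ S, z ∈ S := by
    intro S hS x hx
    by_contra hy
    obtain ⟨h1, h2⟩ := swap S hS x hx _ hy
    exact H _ h1 (by rw [h2]; abel)
  have add_mem : ∀ S : Finset G, S.card = k → ∀ x, x + ∑ z ∈ S, z ∈ S ↔ x ∈ S := by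
    intro S hS x
    have himg : S.image (fun x => x - ∑ z ∈ S, z) = S :=
      Finset.eq_of_subset_of_card_le
        (Finset.image_subset_iff.mpr (sub_mem S hS))
        (Finset.card_image_of_injective _ (sub_left_injective)).ge
    refine ⟨fun h => by simpa using sub_mem S hS _ h, fun h => ?_⟩
    rw [← himg] at h
    obtain ⟨z, hz, rfl⟩ := Finset.mem_image.mp h
    simpa using hz
  have two : ∀ S : Finset G, S.card = k → ∑ z ∈ S, z + ∑ z ∈ S, z = 0 := by
    intro S hS
    obtain ⟨x, hx⟩ : S.Nonempty := Finset.card_pos.mp (by omega)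
    obtain ⟨y, hy⟩ : ∃ y, y ∉ S := by
      by_contra! h
      have := Finset.card_univ (α := G)
      rw [← Finset.eq_univ_of_forall h] at this
      omega
    obtain ⟨h1, h2⟩ := swap S hS x hx y hy
    have hxs : x + ∑ z ∈ S, z ∈ insert y (S.erase x) :=
      Finset.mem_insert_of_mem
        (Finset.mem_erase.mpr ⟨by simpa using H S hS, (add_mem S hS x).mpr hx⟩)
    have h3 := (add_mem _ h1 _).mpr hxs
    rw [h2, show x + ∑ z ∈ S, z + (∑ z ∈ S, z + y - x) = y + ∑ z ∈ S, z + ∑ z ∈ S, z by abel]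
      at h3
    rcases Finset.mem_insert.mp h3 with h | h
    · simpa [add_assoc] using h
    · exact absurd (Finset.mem_of_mem_erase h) (by rwa [add_mem S hS, add_mem S hS])
  have hg0 : g ≠ 0 := by rintro rfl; simp at hg
  obtain ⟨S, hgS, hS0, hSk⟩ := Finset.exists_subsuperset_card_eq (s := {g}) (t := {0}ᶜ) (n := k)
    (by simpa using hg0.symm) (by simpa using hk) (by rw [Finset.card_compl]; simp; omega)
  have h0 : (0 : G) ∉ S := fun h => by simpa using hS0 h
  obtain ⟨h1, h2⟩ := swap S hSk g (hgS (by simp)) 0 h0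
  have h3 := two _ h1
  rw [h2, show ∑ z ∈ S, z + 0 - g + (∑ z ∈ S, z + 0 - g) = (∑ z ∈ S, z + ∑ z ∈ S, z) - (g + g) by
    abel, two S hSk, zero_sub] at h3
  exact hg (neg_eq_zero.mp h3)

section Degree

open WeierstrassCurve.Affine CoordinateRing Polynomial
open scoped Polynomial.Bivariate

variable {W : WeierstrassCurve F}

/-- The pole order at infinity of a function regular on the affine curve. -/
noncomputable def poleOrder (f : W.toAffine.CoordinateRing) : WithBot ℕ :=
  (Algebra.norm F[X] f).degree

theorem le_of_lt_natCast_succ {x : WithBot ℕ} {m : ℕ} (h : x < (m + 1 : ℕ)) : x ≤ m := by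
  cases x with
  | bot => exact bot_le
  | coe d => exact WithBot.coe_le_coe.mpr (Nat.lt_succ_iff.mp (WithBot.coe_lt_coe.mp h))

theorem poleOrder_smul_basis_lt (p q : F[X]) (m : ℕ) :
    poleOrder (p • (1 : W.toAffine.CoordinateRing) + q • CoordinateRing.mk W.toAffine Y) < m ↔
      (∀ j, m ≤ 2 * j → p.coeff j = 0) ∧ ∀ j, m ≤ 2 * j + 3 → q.coeff j = 0 := by
  rw [poleOrder, degree_norm_smul_basis, max_lt_iff]
  refine and_congr ?_ ?_
  · have key : (2 • p.degree < m) ↔ p.degree < ((m + 1) / 2 : ℕ) := by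
      cases p.degree with
      | bot => simp
      | coe d =>
        change 2 • (d : WithBot ℕ) < m ↔ (d : WithBot ℕ) < _
        rw [two_nsmul, ← Nat.cast_add, Nat.cast_lt, Nat.cast_lt]
        omega
    rw [key, degree_lt_iff_coeff_zero]
    exact forall_congr' fun j => ⟨fun h h' => h (by omega), fun h h' => h (by omega)⟩
  · have key : (2 • q.degree + 3 < m) ↔ q.degree < ((m - 2) / 2 : ℕ) := by
      cases q.degree with
      | bot => simp
      | coe d =>
        change 2 • (d : WithBot ℕ) + (3 : ℕ) < m ↔ (d : WithBot ℕ) < _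
        rw [two_nsmul, ← Nat.cast_add, ← Nat.cast_add, Nat.cast_lt, Nat.cast_lt]
        omega
    rw [key, degree_lt_iff_coeff_zero]
    exact forall_congr' fun j => ⟨fun h h' => h (by omega), fun h h' => h (by omega)⟩

theorem poleOrder_eq_bot {f : W.toAffine.CoordinateRing} : poleOrder f = ⊥ ↔ f = 0 := by
  have := Module.Finite.of_basis (CoordinateRing.basis W.toAffine)
  rw [poleOrder, degree_eq_bot, Algebra.norm_eq_zero_iff]

theorem poleOrder_mul (f g : W.toAffine.CoordinateRing) :
    poleOrder (f * g) = poleOrder f + poleOrder g := by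
  simp [poleOrder]

theorem poleOrder_one : poleOrder (1 : W.toAffine.CoordinateRing) = 0 := by
  simp [poleOrder]

theorem poleOrder_X : poleOrder (CoordinateRing.mk W.toAffine (C X)) = 2 := by
  have := degree_norm_smul_basis (W' := W.toAffine) X 0
  rw [zero_smul, add_zero, CoordinateRing.smul, mul_one] at this
  rw [poleOrder, this]; simp

theorem poleOrder_Y : poleOrder (CoordinateRing.mk W.toAffine Y) = 3 := by
  have := degree_norm_smul_basis (W' := W.toAffine) 0 1
  rw [zero_smul, zero_add, one_smul] at this
  rw [poleOrder, this]; simp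

theorem poleOrder_pow (f : W.toAffine.CoordinateRing) (n : ℕ) :
    poleOrder (f ^ n) = n • poleOrder f := by
  simp [poleOrder]

theorem smul_basis_sub_smul (p q p' q' : F[X]) (c : F) :
    p • (1 : W.toAffine.CoordinateRing) + q • CoordinateRing.mk W.toAffine Y -
      c • (p' • (1 : W.toAffine.CoordinateRing) + q' • CoordinateRing.mk W.toAffine Y) =
      (p - c • p') • (1 : W.toAffine.CoordinateRing) +
        (q - c • q') • CoordinateRing.mk W.toAffine Y := by
  simp only [smul_add, sub_smul, smul_assoc]
  abel

theorem poleOrder_sub_smul_lt {f g : W.toAffine.CoordinateRing} {m : ℕ} (hf : poleOrder f < m)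
    (hg : poleOrder g < m) (c : F) : poleOrder (f - c • g) < m := by
  obtain ⟨p, q, rfl⟩ := exists_smul_basis_eq f
  obtain ⟨p', q', rfl⟩ := exists_smul_basis_eq g
  rw [poleOrder_smul_basis_lt] at hf hg
  rw [smul_basis_sub_smul, poleOrder_smul_basis_lt]
  exact ⟨fun j hj => by simp [hf.1 j hj, hg.1 j hj], fun j hj => by simp [hf.2 j hj, hg.2 j hj]⟩

theorem exists_poleOrder_sub_smul_lt {f g : W.toAffine.CoordinateRing} {m : ℕ}
    (hf : poleOrder f = m) (hg : poleOrder g = m) : ∃ c : F, poleOrder (f - c • g) < m := by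
  obtain ⟨p, q, rfl⟩ := exists_smul_basis_eq f
  obtain ⟨p', q', rfl⟩ := exists_smul_basis_eq g
  have hm : (m : WithBot ℕ) < (m + 1 : ℕ) := by norm_cast; omega
  have hf1 := hf.trans_lt hm
  have hg1 := hg.trans_lt hm
  have hg2 := hg.not_lt
  rw [poleOrder_smul_basis_lt] at hf1 hg1 hg2
  simp only [smul_basis_sub_smul, poleOrder_smul_basis_lt, coeff_sub, coeff_smul, smul_eq_mul]
  rw [not_and_or] at hg2
  push Not at hg2
  obtain ⟨i, hi, hi0⟩ | ⟨i, hi, hi0⟩ := hg2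
  · have : ¬ m + 1 ≤ 2 * i := fun h => hi0 (hg1.1 i h)
    refine ⟨p.coeff i / p'.coeff i, fun j hj => ?_, fun j hj => ?_⟩
    · rcases eq_or_ne j i with rfl | hji
      · rw [div_mul_cancel₀ _ hi0, sub_self]
      · rw [hf1.1 j (by omega), hg1.1 j (by omega), mul_zero, sub_zero]
    · rw [hf1.2 j (by omega), hg1.2 j (by omega), mul_zero, sub_zero]
  · have : ¬ m + 1 ≤ 2 * i + 3 := fun h => hi0 (hg1.2 i h)
    refine ⟨q.coeff i / q'.coeff i, fun j hj => ?_, fun j hj => ?_⟩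
    · rw [hf1.1 j (by omega), hg1.1 j (by omega), mul_zero, sub_zero]
    · rcases eq_or_ne j i with rfl | hji
      · rw [div_mul_cancel₀ _ hi0, sub_self]
      · rw [hf1.2 j (by omega), hg1.2 j (by omega), mul_zero, sub_zero]

/-- The monomial functions spanning the Riemann-Roch spaces of multiples of infinity, in order of
increasing pole order. -/
noncomputable def mon (W : WeierstrassCurve F) (j : ℕ) : W.toAffine.CoordinateRing :=
  if j = 0 then 1
  else if (j + 1) % 3 = 0 then CoordinateRing.mk W.toAffine Y ^ ((j + 1) / 3)
  else if (j + 1) % 3 = 2 then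
    CoordinateRing.mk W.toAffine (C X) * CoordinateRing.mk W.toAffine Y ^ ((j + 1) / 3)
  else CoordinateRing.mk W.toAffine (C X) ^ 2 *
    CoordinateRing.mk W.toAffine Y ^ ((j + 1 - 4) / 3)

theorem poleOrder_mon (j : ℕ) :
    poleOrder (mon W j) = ((if j = 0 then 0 else j + 1 : ℕ) : WithBot ℕ) := by
  have h (a b : ℕ) : poleOrder (CoordinateRing.mk W.toAffine (C X) ^ a *
      CoordinateRing.mk W.toAffine Y ^ b) = ((2 * a + 3 * b : ℕ) : WithBot ℕ) := by
    rw [poleOrder_mul, poleOrder_pow, poleOrder_pow, poleOrder_X, poleOrder_Y]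
    simp [mul_comm]
  unfold mon
  split_ifs with h0 h1 h2
  · rw [poleOrder_one]; rfl
  · rw [← one_mul (_ ^ _), ← pow_zero (CoordinateRing.mk W.toAffine (C X)), h]
    congr 1; omega
  · nth_rw 1 [← pow_one (CoordinateRing.mk W.toAffine (C X))]
    rw [h]
    congr 1; omega
  · rw [h]
    congr 1; omega

/-- The function with given coefficients on the first `k` monomials. -/
noncomputable def monSum (W : WeierstrassCurve F) (k : ℕ) (a : ℕ → F) :
    W.toAffine.CoordinateRing :=
  ∑ j ∈ Finset.range k, a j • mon W j

theorem monSum_succ (k : ℕ) (a : ℕ → F) :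
    monSum W (k + 1) a = monSum W k a + a k • mon W k :=
  Finset.sum_range_succ ..

theorem poleOrder_monSum_lt (k : ℕ) (a : ℕ → F) :
    poleOrder (monSum W (k + 1) a) < (k + 2 : ℕ) := by
  have hmon (j k : ℕ) (h : j ≤ k) : poleOrder (mon W j) < (k + 2 : ℕ) := by
    rw [poleOrder_mon]; norm_cast; split_ifs <;> omega
  induction k with
  | zero =>
    rw [monSum_succ, monSum, Finset.sum_range_zero]
    have := poleOrder_sub_smul_lt (f := (0 : W.toAffine.CoordinateRing)) (g := mon W 0) (m := 2)
      (by rw [poleOrder_eq_bot.mpr rfl]; exact WithBot.bot_lt_coe _) (hmon 0 0 le_rfl) (-a 0)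
    simpa using this
  | succ k ih =>
    rw [monSum_succ]
    have := poleOrder_sub_smul_lt (ih.trans (by norm_cast; omega)) (hmon (k + 1) (k + 1) le_rfl)
      (-a (k + 1))
    simpa using this

theorem coeff_eq_zero_of_monSum_eq_zero {k : ℕ} {a : ℕ → F} (h : monSum W k a = 0) :
    ∀ j < k, a j = 0 := by
  induction k with
  | zero => simp
  | succ k ih =>
    rw [monSum_succ] at h
    have hk : a k = 0 := by
      by_contra hk
      have h1 : mon W k = -(a k)⁻¹ • monSum W k a := by
        rw [eq_neg_of_add_eq_zero_left h, smul_neg, neg_smul, neg_neg, smul_smul,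
          inv_mul_cancel₀ hk, one_smul]
      rcases k with _ | k
      · rw [monSum, Finset.sum_range_zero, smul_zero, ← poleOrder_eq_bot, poleOrder_mon] at h1
        simp at h1
      · have h2 := poleOrder_sub_smul_lt (f := (0 : W.toAffine.CoordinateRing))
          (by rw [poleOrder_eq_bot.mpr rfl]; exact WithBot.bot_lt_coe _)
          (poleOrder_monSum_lt (W := W) k a) (a (k + 1))⁻¹
        rw [zero_sub, ← neg_smul, ← h1, poleOrder_mon, Nat.cast_lt] at h2
        simp at h2
    rw [hk, zero_smul, add_zero] at h
    intro j hj
    rcases Nat.lt_succ_iff_lt_or_eq.mp hj with h' | rfl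
    exacts [ih h j h', hk]

theorem exists_eq_monSum {k : ℕ} {f : W.toAffine.CoordinateRing}
    (hf : poleOrder f < (k + 2 : ℕ)) : ∃ a : ℕ → F, f = monSum W (k + 1) a := by
  have step (m : ℕ) (f : W.toAffine.CoordinateRing) (hf : poleOrder f < (m + 1 : ℕ)) (j : ℕ)
      (hj : poleOrder (mon W j) = m) :
      ∃ c : F, poleOrder (f - c • mon W j) < m := by
    rcases (le_of_lt_natCast_succ hf).lt_or_eq with h | h
    · exact ⟨0, by simpa using h⟩
    · exact exists_poleOrder_sub_smul_lt h hj
  induction k generalizing f with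
  | zero =>
    have h1 : poleOrder f < (0 + 1 : ℕ) :=
      lt_of_le_of_ne (le_of_lt_natCast_succ hf) (degree_norm_ne_one f)
    obtain ⟨c, hc⟩ := step 0 f h1 0 (by rw [poleOrder_mon]; rfl)
    have h2 : f - c • mon W 0 = 0 := poleOrder_eq_bot.mp (by simpa using hc)
    exact ⟨fun _ => c, by simpa [monSum] using sub_eq_zero.mp h2⟩
  | succ k ih =>
    obtain ⟨c, hc⟩ := step (k + 2) f hf (k + 1) (by rw [poleOrder_mon]; rfl)
    obtain ⟨a, ha⟩ := ih hc
    refine ⟨Function.update a (k + 1) c, ?_⟩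
    rw [monSum_succ, Function.update_self, ← sub_eq_iff_eq_add, ha]
    refine Finset.sum_congr rfl fun j hj => ?_
    rw [Function.update_of_ne (Finset.mem_range.mp hj).ne]

end Degree

section Ideals

open WeierstrassCurve.Affine CoordinateRing Polynomial
open scoped Polynomial.Bivariate

variable {W : WeierstrassCurve F}

/-- Evaluation of regular functions at an affine point. -/
noncomputable def evalHom {x y : F} (h : W.toAffine.Nonsingular x y) :
    W.toAffine.CoordinateRing →ₐ[F] F :=
  (quotientXYIdealEquiv (W' := W.toAffine) (x := x) (y := C y) h.1).toAlgHom.comp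
    (Ideal.Quotient.mkₐ F (XYIdeal W.toAffine x (C y)))

theorem evalHom_eq_zero {x y : F} (h : W.toAffine.Nonsingular x y)
    {f : W.toAffine.CoordinateRing} : evalHom h f = 0 ↔ f ∈ XYIdeal W.toAffine x (C y) := by
  simp [evalHom, Ideal.Quotient.eq_zero_iff_mem]

theorem evalHom_X {x y : F} (h : W.toAffine.Nonsingular x y) :
    evalHom h (CoordinateRing.mk W.toAffine (C X)) = x := by
  have h1 : evalHom h (XClass W.toAffine x) = 0 :=
    (evalHom_eq_zero h).mpr (Ideal.subset_span (by simp))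
  rw [XClass, C_sub, map_sub, map_sub, sub_eq_zero] at h1
  exact h1.trans ((evalHom h).commutes x)

theorem evalHom_Y {x y : F} (h : W.toAffine.Nonsingular x y) :
    evalHom h (CoordinateRing.mk W.toAffine Y) = y := by
  have h1 : evalHom h (YClass W.toAffine (C y)) = 0 :=
    (evalHom_eq_zero h).mpr (Ideal.subset_span (by simp))
  rw [YClass, map_sub, map_sub, sub_eq_zero] at h1
  exact h1.trans ((evalHom h).commutes y)

/-- Evaluation of regular functions at a point, with value zero at infinity. -/
noncomputable def evalLin : W.toAffine.Point → W.toAffine.CoordinateRing →ₗ[F] F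
  | .zero => 0
  | .some _ _ h => (evalHom h).toLinearMap

/-- The ideal of functions vanishing at an affine point, and the unit ideal at infinity. -/
noncomputable def ptIdeal : W.toAffine.Point → Ideal W.toAffine.CoordinateRing
  | .zero => 1
  | .some x y _ => XYIdeal W.toAffine x (C y)

theorem evalLin_eq_zero {P : W.toAffine.Point} (hP : P ≠ 0) {f : W.toAffine.CoordinateRing} :
    evalLin P f = 0 ↔ f ∈ ptIdeal P := by
  cases P with
  | zero => exact absurd rfl hP
  | some x y h => exact evalHom_eq_zero h

theorem isMaximal_ptIdeal {P : W.toAffine.Point} (hP : P ≠ 0) : (ptIdeal P).IsMaximal := by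
  cases P with
  | zero => exact absurd rfl hP
  | some x y h =>
    have : XYIdeal W.toAffine x (C y) = RingHom.ker (evalHom h) := by
      ext f; rw [RingHom.mem_ker, evalHom_eq_zero h]
    rw [ptIdeal, this]
    exact RingHom.ker_isMaximal_of_surjective _ fun c => ⟨algebraMap _ _ c, (evalHom h).commutes c⟩

theorem ptIdeal_injective : Function.Injective (ptIdeal (W := W)) := by
  rintro (_ | ⟨x, y, h⟩) (_ | ⟨x', y', h'⟩) hPQ
  · rfl
  · exact absurd (hPQ.symm.trans Ideal.one_eq_top)
      (isMaximal_ptIdeal (P := .some x' y' h') (Point.some_ne_zero _)).ne_top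
  · exact absurd (hPQ.trans Ideal.one_eq_top)
      (isMaximal_ptIdeal (P := .some x y h) (Point.some_ne_zero _)).ne_top
  · have hXY : XYIdeal W.toAffine x (C y) = XYIdeal W.toAffine x' (C y') := hPQ
    have hX : evalHom h' (XClass W.toAffine x) = 0 := by
      rw [evalHom_eq_zero]
      exact hXY.le (Ideal.subset_span (by simp))
    have hY : evalHom h' (YClass W.toAffine (C y)) = 0 := by
      rw [evalHom_eq_zero]
      exact hXY.le (Ideal.subset_span (by simp))
    rw [XClass, C_sub, map_sub, map_sub, sub_eq_zero, evalHom_X] at hX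
    rw [YClass, map_sub, map_sub, sub_eq_zero, evalHom_Y] at hY
    obtain rfl : x' = x := hX.trans ((evalHom h').commutes x)
    obtain rfl : y' = y := hY.trans ((evalHom h').commutes y)
    rfl

theorem isCoprime_ptIdeal {P Q : W.toAffine.Point} (hP : P ≠ 0) (hQ : Q ≠ 0) (hPQ : P ≠ Q) :
    IsCoprime (ptIdeal P) (ptIdeal Q) :=
  have := isMaximal_ptIdeal hP
  have := isMaximal_ptIdeal hQ
  Ideal.isCoprime_of_isMaximal (ptIdeal_injective.ne hPQ)

theorem mem_prod_ptIdeal {s : Finset W.toAffine.Point} (hs : ∀ P ∈ s, P ≠ 0)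
    {f : W.toAffine.CoordinateRing} :
    f ∈ ∏ P ∈ s, ptIdeal P ↔ ∀ P ∈ s, evalLin P f = 0 := by
  rw [Ideal.prod_eq_iInf_of_pairwise_isCoprime fun P hP Q hQ hPQ =>
    isCoprime_ptIdeal (hs P hP) (hs Q hQ) hPQ]
  simp only [Ideal.mem_iInf]
  exact forall₂_congr fun P hP => (evalLin_eq_zero (hs P hP)).symm

theorem evalLin_pi_surjective {s : Finset W.toAffine.Point} (hs : ∀ P ∈ s, P ≠ 0) :
    Function.Surjective (LinearMap.pi fun P : s => evalLin P.1) := by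
  intro v
  obtain ⟨f, hf⟩ := Ideal.pi_quotient_surjective (I := fun P : s => ptIdeal P.1)
    (fun P Q hPQ => isCoprime_ptIdeal (hs _ P.2) (hs _ Q.2) fun h => hPQ (Subtype.ext h))
    (fun P => algebraMap F _ (v P))
  refine ⟨f, funext fun P => ?_⟩
  have h1 : f - algebraMap F _ (v P) ∈ ptIdeal P.1 := by
    rw [← Ideal.Quotient.eq_zero_iff_mem, map_sub, sub_eq_zero]
    exact hf P
  rw [← evalLin_eq_zero (hs _ P.2), map_sub, sub_eq_zero] at h1
  rw [LinearMap.pi_apply, h1]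
  obtain ⟨P, hP⟩ := P
  cases P with
  | zero => exact absurd rfl (hs _ hP)
  | some x y h => exact (evalHom h).commutes _

/-- Functions modulo those vanishing at finitely many affine points are determined by their
values. -/
noncomputable def quotientProdEquiv {s : Finset W.toAffine.Point} (hs : ∀ P ∈ s, P ≠ 0) :
    (W.toAffine.CoordinateRing ⧸ ∏ P ∈ s, ptIdeal P) ≃ₗ[F] (s → F) :=
  ((Submodule.quotEquivOfEq _ _ (by
      ext f
      simpa [funext_iff] using! mem_prod_ptIdeal hs)).trans
    ((LinearMap.pi fun P : s => evalLin P.1).quotKerEquivOfSurjective (evalLin_pi_surjective hs)) :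
    (W.toAffine.CoordinateRing ⧸ (∏ P ∈ s, ptIdeal P).restrictScalars F) ≃ₗ[F] (s → F))

theorem finrank_quotient_prod_ptIdeal {s : Finset W.toAffine.Point} (hs : ∀ P ∈ s, P ≠ 0) :
    Module.finrank F (W.toAffine.CoordinateRing ⧸ ∏ P ∈ s, ptIdeal P) = s.card := by
  rw [(quotientProdEquiv hs).finrank_eq]
  simp

/-- The invertible fractional ideal of a point. -/
noncomputable def ptUnit : W.toAffine.Point →
    (FractionalIdeal (nonZeroDivisors W.toAffine.CoordinateRing) W.toAffine.FunctionField)ˣ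
  | .zero => 1
  | .some _ _ h => XYIdeal' h

theorem coe_ptUnit (P : W.toAffine.Point) :
    (ptUnit P : FractionalIdeal (nonZeroDivisors W.toAffine.CoordinateRing)
      W.toAffine.FunctionField) = (ptIdeal P : Ideal W.toAffine.CoordinateRing) := by
  cases P with
  | zero => simp [ptUnit, ptIdeal]
  | some x y h => rfl

theorem mk_ptUnit (P : W.toAffine.Point) :
    ClassGroup.mk W.toAffine.FunctionField (ptUnit P) = (Point.toClass P).toMul := by
  cases P with
  | zero => simp [ptUnit]
  | some x y h => rfl

theorem sum_eq_zero_iff_isPrincipal (s : Finset W.toAffine.Point) :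
    ∑ P ∈ s, P = 0 ↔ ∃ f : W.toAffine.CoordinateRing, f ≠ 0 ∧
      ∏ P ∈ s, ptIdeal P = Ideal.span {f} := by
  rw [← ClassGroup.mk_eq_one_of_coe_ideal (I := ∏ P ∈ s, ptUnit P), ← Point.toClass_eq_zero,
    map_sum, map_prod]
  · simp_rw [mk_ptUnit, ← toMul_sum]
    rfl
  · rw [Units.coe_prod, ← FractionalIdeal.coeIdealHom_apply, map_prod]
    exact Finset.prod_congr rfl fun P _ => coe_ptUnit P

theorem dvd_norm (f : W.toAffine.CoordinateRing) :
    f ∣ algebraMap F[X] W.toAffine.CoordinateRing (Algebra.norm F[X] f) := by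
  obtain ⟨p, q, rfl⟩ := exists_smul_basis_eq f
  have h := coe_norm_smul_basis (W' := W.toAffine) p q
  rw [map_mul] at h
  refine ⟨_, h.trans (congrArg (· * _) ?_)⟩
  rw [CoordinateRing.smul, CoordinateRing.smul, mul_one, map_add, map_mul]

theorem finite_quotient_span {f : W.toAffine.CoordinateRing} (hf : f ≠ 0) :
    Module.Finite F (W.toAffine.CoordinateRing ⧸ Ideal.span {f}) := by
  have hrank := finrank_quotient_span_eq_natDegree_norm (CoordinateRing.basis W.toAffine) hf
  rcases Nat.eq_zero_or_pos (Algebra.norm F[X] f).natDegree with h0 | h0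
  · have hN : Algebra.norm F[X] f ≠ 0 := fun h => hf (poleOrder_eq_bot.mp (degree_eq_bot.mpr h))
    have hu : IsUnit (Algebra.norm F[X] f) := isUnit_iff_degree_eq_zero.mpr
      (by rw [degree_eq_natDegree hN, h0]; rfl)
    have hfu : IsUnit f := isUnit_of_dvd_unit (dvd_norm f) (hu.map (algebraMap _ _))
    rw [Ideal.span_singleton_eq_top.mpr hfu]
    have := Ideal.Quotient.subsingleton_iff.mpr (rfl : (⊤ : Ideal W.toAffine.CoordinateRing) = ⊤)
    infer_instance
  · exact Module.finite_of_finrank_pos (hrank ▸ h0)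

theorem card_le_natDegree_norm {s : Finset W.toAffine.Point} (hs : ∀ P ∈ s, P ≠ 0)
    {f : W.toAffine.CoordinateRing} (hf : f ≠ 0) (h : ∀ P ∈ s, evalLin P f = 0) :
    s.card ≤ (Algebra.norm F[X] f).natDegree ∧
      (s.card = (Algebra.norm F[X] f).natDegree → ∑ P ∈ s, P = 0) := by
  have hle : Ideal.span {f} ≤ ∏ P ∈ s, ptIdeal P :=
    (Ideal.span_singleton_le_iff_mem _).mpr ((mem_prod_ptIdeal hs).mpr h)
  rw [← finrank_quotient_span_eq_natDegree_norm (CoordinateRing.basis W.toAffine) hf,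
    ← finrank_quotient_prod_ptIdeal hs]
  have : Module.Finite F (W.toAffine.CoordinateRing ⧸ Ideal.span {f}) :=
    finite_quotient_span hf
  have hsurj := Ideal.Quotient.factor_surjective hle
  let g := (Ideal.Quotient.factorₐ F hle).toLinearMap
  refine ⟨LinearMap.finrank_le_finrank_of_surjective (f := g) hsurj, fun heq => ?_⟩
  refine (sum_eq_zero_iff_isPrincipal s).mpr ⟨f, hf, le_antisymm (fun z hz => ?_) hle⟩
  have hinj : Function.Injective g := by
    have := (quotientProdEquiv hs).symm.finiteDimensional
    exact (LinearMap.injective_iff_surjective_of_finrank_eq_finrank heq.symm).mpr hsurj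
  rw [← Ideal.Quotient.eq_zero_iff_mem] at hz ⊢
  exact hinj (by rw [map_zero]; exact hz)

end Ideals

section Points

open WeierstrassCurve.Affine Polynomial

variable {W : WeierstrassCurve F}

theorem evalHom_mon {x y : F} (h : W.toAffine.Nonsingular x y) (j : ℕ) :
    evalHom h (mon W j) = if j = 0 then 1 else psi (j + 1) x y := by
  unfold mon psi
  split_ifs <;> simp only [map_one, map_mul, map_pow, evalHom_X, evalHom_Y]

/-- Extension of a finite coefficient vector by zero. -/
def extendZero {k : ℕ} (a : Fin k → F) (j : ℕ) : F :=
  if h : j < k then a ⟨j, h⟩ else 0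

theorem monSum_extendZero {k : ℕ} (a : Fin k → F) :
    monSum W k (extendZero a) = ∑ j : Fin k, a j • mon W j := by
  rw [monSum, Finset.sum_range]
  exact Finset.sum_congr rfl fun j _ => by simp [extendZero]

/-- The value at a point of the linear form with coefficient vector `a`. -/
def hypVal {k : ℕ} (a : Fin k → F) (P : W.toAffine.Point) : F :=
  ∑ j, a j * phiVec W k P j

theorem hypVal_zero {k : ℕ} (hk : 0 < k) (a : Fin k → F) :
    hypVal a (0 : W.toAffine.Point) = a ⟨k - 1, by omega⟩ := by
  rw [hypVal, Finset.sum_eq_single ⟨k - 1, by omega⟩]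
  · change a _ * (if _ then _ else _) = _
    simp
  · intro j _ hj
    change a _ * (if _ then _ else _) = _
    rw [if_neg fun h => hj (Fin.ext h), mul_zero]
  · simp

theorem hypVal_of_ne_zero {k : ℕ} (a : Fin k → F) {P : W.toAffine.Point} (hP : P ≠ 0) :
    hypVal a P = evalLin P (monSum W k (extendZero a)) := by
  cases P with
  | zero => exact absurd rfl hP
  | some x y h =>
    rw [monSum_extendZero]
    change _ = evalHom h _
    simp only [map_sum, map_smul, evalHom_mon, smul_eq_mul]
    rfl

/-- The zeros of a nonzero linear form: there are at most `k` of them, and if there are exactly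
`k`, they sum to zero. -/
theorem card_le_and_sum_eq_zero {k : ℕ} (hk : 3 ≤ k) {a : Fin k → F} (ha : a ≠ 0)
    {s : Finset W.toAffine.Point} (hs : ∀ P ∈ s, hypVal a P = 0) :
    s.card ≤ k ∧ (s.card = k → ∑ P ∈ s, P = 0) := by
  have hf0 : monSum W k (extendZero a) ≠ 0 := fun h => ha <| funext fun j => by
    simpa [extendZero] using coeff_eq_zero_of_monSum_eq_zero h j j.2
  have hs' : ∀ P ∈ s.erase 0, P ≠ 0 := fun P hP => Finset.ne_of_mem_erase hP
  obtain ⟨h1, h2⟩ := card_le_natDegree_norm hs' hf0 fun P hP => by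
    rw [← hypVal_of_ne_zero a (hs' P hP)]
    exact hs P (Finset.mem_of_mem_erase hP)
  rw [Finset.sum_erase s rfl] at h2
  have key : (if (0 : W.toAffine.Point) ∈ s then 1 else 0) +
      (Algebra.norm F[X] (monSum W k (extendZero a))).natDegree ≤ k := by
    obtain ⟨k, rfl⟩ : ∃ m, k = m + 2 := ⟨k - 2, by omega⟩
    split_ifs with h0
    · have hlast := hs 0 h0
      rw [hypVal_zero (by omega)] at hlast
      have h3 : monSum W (k + 2) (extendZero a) = monSum W (k + 1) (extendZero a) := by
        rw [monSum_succ, show extendZero a (k + 1) = 0 by simpa [extendZero] using hlast,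
          zero_smul, add_zero]
      have h4 := natDegree_le_of_degree_le
        (le_of_lt_natCast_succ (poleOrder_monSum_lt (W := W) k (extendZero a)))
      rw [h3]
      omega
    · rw [zero_add]
      exact natDegree_le_of_degree_le (le_of_lt_natCast_succ (poleOrder_monSum_lt (k + 1) _))
  rw [Finset.card_erase_eq_ite] at h1 h2
  split_ifs at key h1 h2 with h0
  · have := Finset.card_pos.mpr ⟨_, h0⟩
    exact ⟨by omega, fun h => h2 (by omega)⟩
  · exact ⟨by omega, fun h => h2 (by omega)⟩

/-- Any `k` points with sum zero lie on a common hyperplane. -/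
theorem exists_hypVal_eq_zero {k : ℕ} (hk : 3 ≤ k) {s : Finset W.toAffine.Point}
    (hsk : s.card = k) (hs : ∑ P ∈ s, P = 0) :
    ∃ a : Fin k → F, a ≠ 0 ∧ ∀ P ∈ s, hypVal a P = 0 := by
  have hs' : ∀ P ∈ s.erase 0, P ≠ 0 := fun P hP => Finset.ne_of_mem_erase hP
  rw [← Finset.sum_erase s rfl, sum_eq_zero_iff_isPrincipal] at hs
  obtain ⟨f, hf0, hf⟩ := hs
  have hdeg : (Algebra.norm F[X] f).natDegree = (s.erase 0).card := by
    rw [← finrank_quotient_span_eq_natDegree_norm (CoordinateRing.basis W.toAffine) hf0, ← hf,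
      finrank_quotient_prod_ptIdeal hs']
  have hvan : ∀ P ∈ s.erase 0, evalLin P f = 0 := (mem_prod_ptIdeal hs').mp
    (hf ▸ Ideal.mem_span_singleton_self f)
  have hlt (m : ℕ) (h : (s.erase 0).card < m) : poleOrder f < (m : ℕ) :=
    degree_le_natDegree.trans_lt (by rw [hdeg]; exact_mod_cast h)
  suffices ∃ a : Fin k → F, monSum W k (extendZero a) = f ∧
      ((0 : W.toAffine.Point) ∈ s → a ⟨k - 1, by omega⟩ = 0) by
    obtain ⟨a, haf, ha0⟩ := this
    refine ⟨a, ?_, fun P hP => ?_⟩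
    · rintro rfl
      exact hf0 (by rw [← haf, monSum_extendZero]; simp)
    · rcases eq_or_ne P 0 with rfl | hP0
      · rw [hypVal_zero (by omega), ha0 hP]
      · rw [hypVal_of_ne_zero a hP0, haf]
        exact hvan P (Finset.mem_erase.mpr ⟨hP0, hP⟩)
  obtain ⟨k, rfl⟩ : ∃ m, k = m + 2 := ⟨k - 2, by omega⟩
  rw [Finset.card_erase_eq_ite] at hlt
  split_ifs at hlt with h0
  · obtain ⟨b, rfl⟩ := exists_eq_monSum (hlt (k + 2) (by omega))
    refine ⟨fun j => if (j : ℕ) < k + 1 then b j else 0, ?_, fun _ => by simp⟩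
    rw [monSum_extendZero, monSum, Fin.sum_univ_castSucc, Finset.sum_range]
    simp [Fin.is_le]
  · obtain ⟨b, rfl⟩ := exists_eq_monSum (hlt (k + 1 + 2) (by omega))
    refine ⟨fun j => b j, ?_, fun h => absurd h h0⟩
    rw [monSum_extendZero, monSum, Finset.sum_range]

theorem exists_add_self_ne_zero [W.IsElliptic] [Fintype W.toAffine.Point]
    (h12 : 12 ≤ Fintype.card W.toAffine.Point) : ∃ P : W.toAffine.Point, P + P ≠ 0 := by
  by_contra! H
  have hroot (x y : F) (h : W.toAffine.Nonsingular x y) :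
      4 * x ^ 3 + W.b₂ * x ^ 2 + 2 * W.b₄ * x + W.b₆ = 0 := by
    have h1 : y = W.toAffine.negY x y := by
      have h2 := eq_neg_of_add_eq_zero_left (H (.some x y h))
      rw [Point.neg_some, Point.some.injEq] at h2
      exact h2.2
    have h3 := (equation_iff ..).mp h.1
    rw [negY] at h1
    simp only [b₂, b₄, b₆]
    linear_combination (2 * y + W.a₁ * x + W.a₃) * h1 - 4 * h3
  let p : F[X] := C 4 * X ^ 3 + C W.b₂ * X ^ 2 + C (2 * W.b₄) * X + C W.b₆
  have hp0 : p ≠ 0 := by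
    intro hp
    have c0 : W.b₆ = 0 := by simpa [p] using congrArg (fun p => coeff p 0) hp
    have c2 : W.b₂ = 0 := by simpa [p, coeff_X, coeff_C] using congrArg (fun p => coeff p 2) hp
    have c3 : (4 : F) = 0 := by simpa [p, coeff_X, coeff_C] using congrArg (fun p => coeff p 3) hp
    have hΔ : W.Δ = 0 := by
      rw [Δ, c0, c2]
      linear_combination (-2 * W.b₄ ^ 3) * c3
    exact W.isUnit_Δ.ne_zero hΔ
  have hpd : p.natDegree ≤ 3 := by simp only [p]; compute_degree
  let g : W.toAffine.Point → Option F
    | .zero => none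
    | .some x _ _ => some x
  have hg : Function.Injective g := by
    rintro (_ | ⟨x, y, h⟩) (_ | ⟨x', y', h'⟩) hPQ
    · rfl
    · exact absurd hPQ (by simp [g])
    · exact absurd hPQ (by simp [g])
    · rcases Point.X_eq_iff (h₁ := h) (h₂ := h') |>.mp (Option.some.inj hPQ) with h1 | h1
      · exact h1
      · rw [h1, ← eq_neg_of_add_eq_zero_left (H _)]
  have hsub : Finset.univ.image g ⊆ Finset.insertNone p.roots.toFinset := by
    intro z hz
    obtain ⟨P, -, rfl⟩ := Finset.mem_image.mp hz
    cases P with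
    | zero => simp [g]
    | some x y h =>
      exact Finset.some_mem_insertNone.mpr (Multiset.mem_toFinset.mpr
        ((mem_roots hp0).mpr (by simpa [p] using hroot x y h)))
  have h1 := Finset.card_le_card hsub
  rw [Finset.card_image_of_injective _ hg, Finset.card_univ, Finset.card_insertNone] at h1
  have h2 := Multiset.toFinset_card_le p.roots
  have h3 := p.card_roots'
  omega

end Points

section Codes

theorem minDist_eq {n d : ℕ} {C : Submodule F (Fin n → F)}
    (hd : ∃ x ∈ C, x ≠ 0 ∧ hammingNorm x = d) (hle : ∀ x ∈ C, x ≠ 0 → d ≤ hammingNorm x) :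
    minDist C = d :=
  IsLeast.csInf_eq ⟨hd, fun _ ⟨x, hx, hx0, h⟩ => h ▸ hle x hx hx0⟩

/-- The code spanned by the rows of the matrix with columns `v j`. -/
def columnCode {n k : ℕ} (v : Fin n → Fin k → F) : Submodule F (Fin n → F) :=
  Submodule.span F (Set.range fun i : Fin k => fun j : Fin n => v j i)

theorem mem_columnCode {n k : ℕ} {v : Fin n → Fin k → F} {x : Fin n → F} :
    x ∈ columnCode v ↔ ∃ a : Fin k → F, x = fun j => ∑ i, a i * v j i := by
  rw [columnCode, Submodule.mem_span_range_iff_exists_fun]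
  refine exists_congr fun a => ⟨fun h => ?_, fun h => ?_⟩
  · rw [← h]; ext j; simp
  · rw [h]; ext j; simp

theorem mem_dualCode_columnCode {n k : ℕ} {v : Fin n → Fin k → F} {c : Fin n → F} :
    c ∈ dualCode (columnCode v) ↔ ∀ i, ∑ j, c j * v j i = 0 := by
  simp only [dualCode, Submodule.mem_iInf, LinearMap.mem_ker]
  refine ⟨fun h i => h _ (Submodule.subset_span ⟨i, rfl⟩), fun h y hy => ?_⟩
  obtain ⟨a, rfl⟩ := mem_columnCode.mp hy
  change ∑ j, c j * ∑ i, a i * v j i = 0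
  simp_rw [Finset.mul_sum]
  rw [Finset.sum_comm]
  refine Finset.sum_eq_zero fun i _ => ?_
  rw [← mul_zero (a i), ← h i, Finset.mul_sum]
  exact Finset.sum_congr rfl fun j _ => by ring

theorem finrank_dualCode_columnCode {n k : ℕ} (v : Fin n → Fin k → F) :
    Module.finrank F (columnCode v) + Module.finrank F (dualCode (columnCode v)) = n := by
  let M : Matrix (Fin k) (Fin n) F := Matrix.of fun i j => v j i
  have h1 : dualCode (columnCode v) = LinearMap.ker M.mulVecLin := by
    ext c
    rw [mem_dualCode_columnCode, LinearMap.mem_ker, Matrix.mulVecLin_apply, funext_iff]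
    refine forall_congr' fun i => ?_
    simp [M, Matrix.mulVec, dotProduct, mul_comm]
  have h2 : Module.finrank F (columnCode v) = M.rank := M.rank_eq_finrank_span_row.symm
  rw [h1, h2, Matrix.rank, LinearMap.finrank_range_add_finrank_ker, Module.finrank_fin_fun]

theorem hammingNorm_add_card_zeros {n : ℕ} (x : Fin n → F) :
    hammingNorm x + (Finset.univ.filter fun j => x j = 0).card = n := by
  have := Finset.card_filter_add_card_filter_not (s := Finset.univ) fun j => x j = 0
  rw [Finset.card_univ, Fintype.card_fin] at this
  simp only [hammingNorm, ne_eq]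
  omega

/-- A vector orthogonal to `k` vectors in dimension `k` yields a linear relation among them. -/
theorem exists_dual_hammingNorm_le {n k : ℕ} {v : Fin n → Fin k → F} {a : Fin k → F} (ha : a ≠ 0)
    (hcard : (Finset.univ.filter fun j => ∑ i, a i * v j i = 0).card = k) :
    ∃ c ∈ dualCode (columnCode v), c ≠ 0 ∧ hammingNorm c ≤ k := by
  set T := Finset.univ.filter fun j => ∑ i, a i * v j i = 0 with hT
  let σ : Fin k → Fin n := fun r => T.orderEmbOfFin hcard r
  have hσ : Function.Injective σ := (T.orderEmbOfFin hcard).injective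
  have hσT (r : Fin k) : σ r ∈ T := T.orderEmbOfFin_mem hcard r
  let M : Matrix (Fin k) (Fin k) F := Matrix.of fun r i => v (σ r) i
  have hM : M.det = 0 := Matrix.exists_mulVec_eq_zero_iff.mp ⟨a, ha, funext fun r => by
    have := (Finset.mem_filter.mp (hσT r)).2
    simpa [M, Matrix.mulVec, dotProduct, mul_comm] using this⟩
  obtain ⟨c, hc0, hc⟩ := Matrix.exists_vecMul_eq_zero_iff.mpr hM
  refine ⟨Function.extend σ c 0, mem_dualCode_columnCode.mpr fun i => ?_, fun h => hc0 ?_, ?_⟩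
  · rw [← Fintype.sum_of_injective σ hσ (fun r => c r * v (σ r) i)]
    · exact congrFun hc i
    · intro j hj
      rw [Function.extend_apply' _ _ _ (by simpa using hj)]
      simp
    · intro r
      rw [hσ.extend_apply]
  · ext r
    rw [← hσ.extend_apply c 0 r, h]
    rfl
  · rw [hammingNorm]
    refine (Finset.card_le_card (t := T) fun j hj => ?_).trans hcard.le
    by_contra hjT
    refine (Finset.mem_filter.mp hj).2 (Function.extend_apply' _ _ _ ?_)
    rintro ⟨r, rfl⟩
    exact hjT (hσT r)

theorem isNMDS_columnCode {n k : ℕ} (hkn : k < n) {v : Fin n → Fin k → F}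
    (hzeros : ∀ a : Fin k → F, a ≠ 0 →
      (Finset.univ.filter fun j => ∑ i, a i * v j i = 0).card ≤ k)
    (hex : ∃ a : Fin k → F, a ≠ 0 ∧
      (Finset.univ.filter fun j => ∑ i, a i * v j i = 0).card = k)
    (hdual : ∀ c ∈ dualCode (columnCode v), c ≠ 0 → k ≤ hammingNorm c) :
    IsNMDS (columnCode v) := by
  have hrank : Module.finrank F (columnCode v) = k := by
    rw [columnCode, finrank_span_eq_card, Fintype.card_fin]
    refine Fintype.linearIndependent_iff.mpr fun a ha => ?_
    by_contra hne
    have ha0 : a ≠ 0 := fun h => hne fun i => congrFun h i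
    have := hzeros a ha0
    rw [Finset.filter_true_of_mem, Finset.card_univ, Fintype.card_fin] at this
    · omega
    · intro j _
      simpa using congrFun ha j
  obtain ⟨a, ha0, ha⟩ := hex
  have hd : minDist (columnCode v) = n - k := by
    refine minDist_eq ⟨fun j => ∑ i, a i * v j i, mem_columnCode.mpr ⟨a, rfl⟩, ?_, ?_⟩ ?_
    · intro h
      rw [Finset.filter_true_of_mem (p := fun j => ∑ i, a i * v j i = 0) fun j _ => congrFun h j,
        Finset.card_univ, Fintype.card_fin] at ha
      omega
    · have := hammingNorm_add_card_zeros fun j => ∑ i, a i * v j i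
      omega
    · intro x hx hx0
      obtain ⟨b, rfl⟩ := mem_columnCode.mp hx
      have hb : b ≠ 0 := by
        rintro rfl
        exact hx0 (by ext; simp)
      have h1 := hammingNorm_add_card_zeros fun j => ∑ i, b i * v j i
      have h2 := hzeros b hb
      omega
  have hd' : minDist (dualCode (columnCode v)) = k := by
    obtain ⟨c, hc, hc0, hck⟩ := exists_dual_hammingNorm_le ha0 ha
    exact minDist_eq ⟨c, hc, hc0, le_antisymm hck (hdual c hc hc0)⟩ hdual
  have hdim := finrank_dualCode_columnCode v
  constructor <;> simp only [singletonDefect] <;> omega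

theorem exists_forall_sum_eq_zero {n k : ℕ} (v : Fin n → Fin k → F) {s : Finset (Fin n)}
    (hs : s.card < k) : ∃ a : Fin k → F, a ≠ 0 ∧ ∀ j ∈ s, ∑ i, a i * v j i = 0 := by
  let M : Matrix s (Fin k) F := Matrix.of fun j i => v j i
  have hker : LinearMap.ker M.mulVecLin ≠ ⊥ :=
    LinearMap.ker_ne_bot_of_finrank_lt (by simpa using hs)
  obtain ⟨a, ha, ha0⟩ := Submodule.exists_mem_ne_zero_of_ne_bot hker
  refine ⟨a, ha0, fun j hj => ?_⟩
  have := congrFun (LinearMap.mem_ker.mp ha) ⟨j, hj⟩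
  simpa [M, Matrix.mulVec, dotProduct, mul_comm] using this

/-- If every `k` columns on a hyperplane have labels summing to zero, any relation among the
columns involves at least `k` of them. -/
theorem le_hammingNorm_of_mem_dualCode {n k : ℕ} (hkn : k < n) {v : Fin n → Fin k → F}
    {G : Type*} [AddCommGroup G] {e : Fin n → G} (he : Function.Injective e)
    (hsum : ∀ a : Fin k → F, a ≠ 0 → ∀ s : Finset (Fin n), s.card = k →
      (∀ j ∈ s, ∑ i, a i * v j i = 0) → ∑ j ∈ s, e j = 0)
    {c : Fin n → F} (hc : c ∈ dualCode (columnCode v)) (hc0 : c ≠ 0) : k ≤ hammingNorm c := by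
  by_contra! hlt
  obtain ⟨p, hp⟩ := Function.ne_iff.mp hc0
  obtain ⟨A, hA, -, hAk⟩ := Finset.exists_subsuperset_card_eq
    (Finset.subset_univ (Finset.univ.filter fun j => c j ≠ 0)) (n := k - 1)
    (Nat.le_sub_one_of_lt hlt) (by rw [Finset.card_univ, Fintype.card_fin]; omega)
  have hpA : p ∈ A := hA (by simpa using hp)
  have hApos := Finset.card_pos.mpr ⟨p, hpA⟩
  have hq (q : Fin n) (hq : q ∉ A) : e q = -∑ j ∈ A, e j := by
    have hq' : q ∉ A.erase p := fun h => hq (Finset.mem_of_mem_erase h)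
    obtain ⟨a, ha0, ha⟩ := exists_forall_sum_eq_zero v (s := insert q (A.erase p))
      (by rw [Finset.card_insert_of_notMem hq', Finset.card_erase_of_mem hpA]; omega)
    have hpair : ∑ j, c j * ∑ i, a i * v j i = 0 := by
      simpa [dualCode, dotLin] using
        (Submodule.mem_iInf _).mp ((Submodule.mem_iInf _).mp hc _) (mem_columnCode.mpr ⟨a, rfl⟩)
    rw [Finset.sum_eq_single_of_mem p (Finset.mem_univ p)] at hpair
    · have hpz := (mul_eq_zero.mp hpair).resolve_left hp
      have := hsum a ha0 (insert q A) (by rw [Finset.card_insert_of_notMem hq]; omega) <| by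
        intro j hj
        rcases eq_or_ne j p with rfl | hjp
        · exact hpz
        · refine ha j ?_
          simp only [Finset.mem_insert, Finset.mem_erase] at hj ⊢
          tauto
      rw [Finset.sum_insert hq] at this
      exact eq_neg_of_add_eq_zero_left this
    · intro j _ hjp
      by_cases hjA : j ∈ A
      · rw [ha j (by simp [hjA, hjp]), mul_zero]
      · have : c j = 0 := by
          by_contra h
          exact hjA (hA (by simpa using h))
        rw [this, zero_mul]
  obtain ⟨q, hqA, q', hqA', hne⟩ := Finset.one_lt_card.mp
    (show 1 < Aᶜ.card by rw [Finset.card_compl, Fintype.card_fin]; omega)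
  exact hne (he ((hq q (by simpa using hqA)).trans (hq q' (by simpa using hqA')).symm))

end Codes

section Projective

variable {W : WeierstrassCurve F}

theorem onHyp_phiProj {k : ℕ} (hk : 0 < k) (a : Fin k → F) (P : W.toAffine.Point) :
    OnHyp a (phiProj W hk P) ↔ hypVal a P = 0 := by
  obtain ⟨u, hu⟩ := Projectivization.exists_smul_eq_mk_rep F _ (phiVec_ne_zero W hk P)
  have : ∑ i, a i * (phiProj W hk P).rep i = (u : F) * hypVal a P := by
    rw [phiProj, ← hu, hypVal, Finset.mul_sum]
    exact Finset.sum_congr rfl fun i _ => by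
      simp only [Pi.smul_apply, Units.smul_def, smul_eq_mul]; ring
  rw [OnHyp, this, mul_eq_zero, or_iff_right u.ne_zero]

theorem phiProj_injective {k : ℕ} (hk : 3 ≤ k) :
    Function.Injective (phiProj W (show 0 < k by omega)) := by
  have h0 : ∀ {x y : F} (h : W.toAffine.Nonsingular x y),
      phiVec W k (.some x y h) ⟨0, by omega⟩ = 1 ∧ phiVec W k (.some x y h) ⟨1, by omega⟩ = x ∧
        phiVec W k (.some x y h) ⟨2, by omega⟩ = y := by
    intro x y h
    simp [phiVec, psi]
  have hz : phiVec W k .zero ⟨0, by omega⟩ = 0 := by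
    simp only [phiVec]
    rw [if_neg (by omega)]
  intro P Q hPQ
  obtain ⟨u, hu⟩ := (Projectivization.mk_eq_mk_iff ..).mp hPQ
  have hu0 := congrFun hu ⟨0, by omega⟩
  have hu1 := congrFun hu ⟨1, by omega⟩
  have hu2 := congrFun hu ⟨2, by omega⟩
  simp only [Pi.smul_apply, Units.smul_def, smul_eq_mul] at hu0 hu1 hu2
  rcases P with _ | ⟨x, y, h⟩ <;> rcases Q with _ | ⟨x', y', h'⟩
  · rfl
  · rw [hz, (h0 h').1] at hu0; simp at hu0
  · rw [hz, (h0 h).1] at hu0; simp at hu0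
  · rw [(h0 h).1, (h0 h').1, mul_one] at hu0
    rw [(h0 h).2.1, (h0 h').2.1, hu0, one_mul] at hu1
    rw [(h0 h).2.2, (h0 h').2.2, hu0, one_mul] at hu2
    subst hu1 hu2
    rfl

end Projective

/-- If `E/F_q` has `n ≥ 12` rational points and `3 ≤ k ≤ n - 1`, then the
`k`-elliptic code associated to `E` is near-MDS (in particular not MDS); equivalently, some
hyperplane of `P^{k-1}(F_q)` meets `φ_k(E(F_q))` in exactly `k` points. -/
theorem statement1 (W : WeierstrassCurve F) [W.IsElliptic] {n : ℕ}
    (hn : n = Nat.card W.toAffine.Point) (hn12 : 12 ≤ n) (e : Fin n ≃ W.toAffine.Point)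
    {k : ℕ} (hk3 : 3 ≤ k) (hkn : k ≤ n - 1) :
    IsNMDS (ellipticCode W k e) ∧ ¬ IsMDS (ellipticCode W k e) ∧
      ∃ a : Fin k → F, a ≠ 0 ∧
        Set.ncard {p ∈ Set.range (phiProj W (show 0 < k by omega)) | OnHyp a p} = k := by
  have : Fintype W.toAffine.Point := Fintype.ofEquiv _ e
  have hcard : Fintype.card W.toAffine.Point = n := by rw [hn, Nat.card_eq_fintype_card]
  obtain ⟨g, hg⟩ := exists_add_self_ne_zero (W := W) (hcard ▸ hn12)
  obtain ⟨S, hSk, hS⟩ := exists_card_eq_sum_eq_zero hg (k := k) (by omega) (by omega)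
  obtain ⟨a, ha0, ha⟩ := exists_hypVal_eq_zero hk3 hSk hS
  have hle (b : Fin k → F) (hb : b ≠ 0) :
      (Finset.univ.filter fun P : W.toAffine.Point => hypVal b P = 0).card ≤ k :=
    (card_le_and_sum_eq_zero hk3 hb fun P hP => (Finset.mem_filter.mp hP).2).1
  have hzeros : (Finset.univ.filter fun P : W.toAffine.Point => hypVal a P = 0) = S :=
    (Finset.eq_of_subset_of_card_le (fun P hP => by simpa using ha P hP)
      (hSk ▸ hle a ha0)).symm
  have hmap (b : Fin k → F) :
      (Finset.univ.filter fun j => ∑ i, b i * phiVec W k (e j) i = 0).card =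
        (Finset.univ.filter fun P : W.toAffine.Point => hypVal b P = 0).card :=
    Finset.card_equiv e fun j => by simp only [Finset.mem_filter_univ]; rfl
  have hnmds : IsNMDS (ellipticCode W k e) := by
    refine isNMDS_columnCode (v := fun j => phiVec W k (e j)) (by omega) (fun b hb => ?_)
      ⟨a, ha0, by rw [hmap, hzeros, hSk]⟩ fun c hc hc0 =>
        le_hammingNorm_of_mem_dualCode (by omega) e.injective (fun b hb s hs hsb => ?_) hc hc0
    · rw [hmap]
      exact hle b hb
    · have := (card_le_and_sum_eq_zero hk3 hb (s := s.map e.toEmbedding) fun P hP => by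
        obtain ⟨j, hj, rfl⟩ := Finset.mem_map.mp hP
        exact hsb j hj).2 (by rw [Finset.card_map, hs])
      simpa using this
  refine ⟨hnmds, fun h => ?_, a, ha0, ?_⟩
  · rw [IsMDS, hnmds.1] at h
    exact one_ne_zero h
  · have hset : {p ∈ Set.range (phiProj W (show 0 < k by omega)) | OnHyp a p} =
        phiProj W (show 0 < k by omega) '' (S : Set W.toAffine.Point) := by
      ext p
      simp only [Set.mem_ofPred_eq, Set.mem_range, Set.mem_image, ← hzeros]
      constructor
      · rintro ⟨⟨P, rfl⟩, h⟩
        exact ⟨P, by simpa using (onHyp_phiProj _ a P).mp h, rfl⟩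
      · rintro ⟨P, hP, rfl⟩
        exact ⟨⟨P, rfl⟩, (onHyp_phiProj _ a P).mpr (by simpa using hP)⟩
    rw [hset, Set.ncard_image_of_injective _ (phiProj_injective hk3), Set.ncard_coe_finset, hSk]

end NMDS
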